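/- For every integer r ≥ 0, Σ_{i=0}^{r} (-1)^{r-i} (δ_{i0} + 1) ζ₋({1}^{r-i}, 2+i) = ζ(r+2), where δ_{i0} is Kronecker's delta. -/

import Mathlib

open scoped BigOperators

/-- Alternating multiple zeta value ζ₋, encoded with mᵢ = m i + 1. -/
noncomputable def zetaMinus {n : ℕ} (k : Fin (n + 1) → ℕ) : ℝ :=
  ∑' m : Fin (n + 1) → ℕ, if StrictMono m then
    (-1 : ℝ) ^ (m (Fin.last n)) * ∏ i, (1 : ℝ) / ((m i + 1 : ℝ) ^ (k i)) else 0

open Finset Filter Topology MeasureTheory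

/-- The elementary symmetric function of degree `k` in `1, 1/2, …, 1/n`. -/
noncomputable def elemHarmonic : ℕ → ℕ → ℝ
  | 0, _ => 1
  | k + 1, n => ∑ l ∈ range n, elemHarmonic k l / (l + 1)

lemma elemHarmonic_nonneg (k n : ℕ) : 0 ≤ elemHarmonic k n := by
  induction k generalizing n with
  | zero => simp [elemHarmonic]
  | succ k ih => exact sum_nonneg fun l _ => div_nonneg (ih l) (by positivity)

lemma elemHarmonic_succ_succ (k n : ℕ) :
    elemHarmonic (k + 1) (n + 1) = elemHarmonic (k + 1) n + elemHarmonic k n / (n + 1) := by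
  simp [elemHarmonic, sum_range_succ]

lemma sum_one_div_sqrt_le (n : ℕ) :
    ∑ l ∈ range n, 1 / √((l : ℝ) + 1) ≤ 2 * √(n : ℝ) := by
  induction n with
  | zero => simp
  | succ n ih =>
    rw [sum_range_succ]
    have hpos : 0 < √((n : ℝ) + 1) := Real.sqrt_pos.2 (by positivity)
    have hsq : √((n : ℝ) + 1) ^ 2 = n + 1 := Real.sq_sqrt (by positivity)
    have hsq' : √(n : ℝ) ^ 2 = n := Real.sq_sqrt (by positivity)
    have hstep : 1 / √((n : ℝ) + 1) ≤ 2 * √((n : ℝ) + 1) - 2 * √(n : ℝ) := by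
      rw [div_le_iff₀ hpos]
      nlinarith [sq_nonneg (√((n : ℝ) + 1) - √(n : ℝ))]
    push_cast
    linarith

lemma elemHarmonic_le (k n : ℕ) : elemHarmonic k n ≤ 2 ^ k * √((n : ℝ) + 1) := by
  induction k generalizing n with
  | zero => simp [elemHarmonic]
  | succ k ih =>
    calc elemHarmonic (k + 1) n
        ≤ ∑ l ∈ range n, 2 ^ k * (1 / √((l : ℝ) + 1)) := by
          refine sum_le_sum fun l _ => ?_
          have hpos : 0 < √((l : ℝ) + 1) := Real.sqrt_pos.2 (by positivity)
          have hsq : √((l : ℝ) + 1) * √((l : ℝ) + 1) = l + 1 :=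
            Real.mul_self_sqrt (by positivity)
          calc elemHarmonic k l / (l + 1) ≤ 2 ^ k * √((l : ℝ) + 1) / (l + 1) := by
                gcongr; exact ih l
            _ = 2 ^ k * (1 / √((l : ℝ) + 1)) := by
                rw [mul_div_assoc]; nth_rewrite 2 [← hsq]; field_simp
      _ ≤ 2 ^ k * (2 * √(n : ℝ)) := by
          rw [← mul_sum]; gcongr; exact sum_one_div_sqrt_le n
      _ ≤ 2 ^ (k + 1) * √((n : ℝ) + 1) := by
          rw [pow_succ, mul_assoc]; gcongr; linarith

lemma summable_elemHarmonic_div (k i : ℕ) :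
    Summable fun n : ℕ => elemHarmonic k n / ((n : ℝ) + 1) ^ (2 + i) := by
  have hs : Summable fun n : ℕ => 2 ^ k * (1 / ((n : ℝ) + 1) ^ (3 / 2 : ℝ)) := by
    have := (summable_nat_add_iff 1).2
      (Real.summable_one_div_nat_rpow (p := 3 / 2) |>.2 (by norm_num))
    exact (by simpa using this : Summable fun n : ℕ => 1 / ((n : ℝ) + 1) ^ (3 / 2 : ℝ)).mul_left _
  refine hs.of_nonneg_of_le (fun n => div_nonneg (elemHarmonic_nonneg k n) (by positivity)) ?_
  intro n
  have h1 : (1 : ℝ) ≤ (n : ℝ) + 1 := by simp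
  have h0 : (0 : ℝ) < (n : ℝ) + 1 := by positivity
  have hsplit : ((n : ℝ) + 1) ^ 2 = ((n : ℝ) + 1) ^ (3 / 2 : ℝ) * √((n : ℝ) + 1) := by
    rw [Real.sqrt_eq_rpow, ← Real.rpow_add h0, ← Real.rpow_natCast]; norm_num
  calc elemHarmonic k n / ((n : ℝ) + 1) ^ (2 + i)
      ≤ (2 ^ k * √((n : ℝ) + 1)) / ((n : ℝ) + 1) ^ 2 := by
        gcongr
        · exact elemHarmonic_le k n
        · omega
    _ = 2 ^ k * (1 / ((n : ℝ) + 1) ^ (3 / 2 : ℝ)) := by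
        rw [hsplit]; field_simp

lemma summable_elemHarmonic_mul_pow (k : ℕ) {t : ℝ} (ht0 : 0 ≤ t) (ht1 : t < 1) :
    Summable fun n : ℕ => elemHarmonic k n * t ^ n := by
  have h1 : Summable fun n : ℕ => ((n : ℝ) ^ 1 * t ^ n) :=
    summable_pow_mul_geometric_of_norm_lt_one 1 (by rwa [Real.norm_of_nonneg ht0])
  have h2 := (h1.add (summable_geometric_of_lt_one ht0 ht1)).mul_left (2 ^ k)
  refine h2.of_nonneg_of_le (fun n => mul_nonneg (elemHarmonic_nonneg k n) (by positivity)) ?_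
  intro n
  have hle : √((n : ℝ) + 1) ≤ n + 1 := by
    rw [Real.sqrt_le_left (by positivity)]
    have : (0 : ℝ) ≤ n := by positivity
    nlinarith
  calc elemHarmonic k n * t ^ n ≤ (2 ^ k * (n + 1)) * t ^ n := by
        gcongr; exact (elemHarmonic_le k n).trans (by gcongr)
    _ = 2 ^ k * ((n : ℝ) ^ 1 * t ^ n + t ^ n) := by ring

lemma HasSum.of_term_eq {ι : Type*} {f g : ι → ℝ} {a b : ℝ} (h : HasSum f a)
    (hfg : ∀ n, g n = f n) (hab : b = a) : HasSum g b := by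
  rw [hab, funext hfg]
  exact h

lemma Fin.strictMono_snoc_iff {α : Type*} [Preorder α] {k : ℕ} (m : Fin k → α) (l : α) :
    StrictMono (Fin.snoc m l : Fin (k + 1) → α) ↔ StrictMono m ∧ ∀ i, m i < l := by
  constructor
  · intro h
    refine ⟨fun i j hij => ?_, fun i => ?_⟩
    · simpa using h (Fin.castSucc_lt_castSucc_iff.2 hij)
    · simpa using h (Fin.castSucc_lt_last i)
  · rintro ⟨hm, hl⟩ i j hij
    induction j using Fin.lastCases with
    | last =>
      induction i using Fin.lastCases with
      | last => exact absurd hij (lt_irrefl _)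
      | cast i => simpa using hl i
    | cast j =>
      induction i using Fin.lastCases with
      | last => exact absurd hij (Fin.le_last _).not_gt
      | cast i => simpa using hm (Fin.castSucc_lt_castSucc_iff.1 hij)

lemma HasSum.prod_of_norm {α β : Type*} {f : α × β → ℝ} {g h : α → ℝ} {s : ℝ}
    (hnorm : ∀ a, HasSum (fun b => ‖f (a, b)‖) (h a)) (hh : Summable h)
    (hf : ∀ a, HasSum (fun b => f (a, b)) (g a)) (hg : HasSum g s) : HasSum f s := by
  have hsum : Summable f := by
    refine Summable.of_norm ((summable_prod_of_nonneg fun _ => norm_nonneg _).2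
      ⟨fun a => (hnorm a).summable, ?_⟩)
    exact hh.congr fun a => (hnorm a).tsum_eq.symm
  rw [← (hsum.hasSum.prod_fiberwise hf).unique hg]
  exact hsum.hasSum

lemma hasSum_strictMono_snoc {k : ℕ} {w : ℕ → ℝ} {s : ℝ}
    (hk : ∀ l : ℕ, HasSum (fun m : Fin k → ℕ => if StrictMono m ∧ ∀ i, m i < l then
      ∏ i, (1 : ℝ) / ((m i : ℝ) + 1) else 0) (elemHarmonic k l))
    (hsum : Summable fun l => ‖w l‖ * elemHarmonic k l)
    (hs : HasSum (fun l => w l * elemHarmonic k l) s) :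
    HasSum (fun m : Fin (k + 1) → ℕ => if StrictMono m then
      w (m (Fin.last k)) * ∏ i : Fin k, (1 : ℝ) / ((m i.castSucc : ℝ) + 1) else 0) s := by
  rw [← (Fin.snocEquiv fun _ : Fin (k + 1) => ℕ).hasSum_iff]
  have hterm (l : ℕ) (m : Fin k → ℕ) :
      ((fun m : Fin (k + 1) → ℕ => if StrictMono m then
        w (m (Fin.last k)) * ∏ i : Fin k, (1 : ℝ) / ((m i.castSucc : ℝ) + 1) else 0) ∘
        (Fin.snocEquiv fun _ : Fin (k + 1) => ℕ)) (l, m) =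
      w l * if StrictMono m ∧ ∀ i, m i < l then ∏ i, (1 : ℝ) / ((m i : ℝ) + 1) else 0 := by
    simp [Fin.snocEquiv, Fin.strictMono_snoc_iff]
  refine HasSum.prod_of_norm (fun l => ?_) hsum (fun l => ?_) hs
  · simp only [hterm, norm_mul]
    refine ((hk l).mul_left ‖w l‖).of_term_eq (fun m => ?_) rfl
    congr 1
    refine Real.norm_of_nonneg ?_
    split_ifs <;> positivity
  · simp only [hterm]
    exact (hk l).mul_left (w l)

lemma hasSum_elemHarmonic (k n : ℕ) :
    HasSum (fun m : Fin k → ℕ => if StrictMono m ∧ ∀ i, m i < n then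
      ∏ i, (1 : ℝ) / ((m i : ℝ) + 1) else 0) (elemHarmonic k n) := by
  induction k generalizing n with
  | zero =>
    simp [elemHarmonic, Subsingleton.strictMono]
  | succ k ih =>
    let w : ℕ → ℝ := fun l => if l < n then 1 / ((l : ℝ) + 1) else 0
    have hfin (v : ℕ → ℝ) (hv : ∀ l, n ≤ l → v l = 0) :
        HasSum (fun l => v l * elemHarmonic k l) (∑ l ∈ range n, v l * elemHarmonic k l) :=
      hasSum_sum_of_ne_finset_zero fun l hl => by
        rw [hv l (by simpa using hl), zero_mul]
    have hw (l : ℕ) (hl : n ≤ l) : w l = 0 := by simp [w, hl.not_gt]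
    have h := hasSum_strictMono_snoc ih (w := w)
      (hfin (fun l => ‖w l‖) fun l hl => by simp [hw l hl]).summable (hfin w hw)
    convert h using 1
    · funext m
      by_cases hm : StrictMono m
      · by_cases hl : m (Fin.last k) < n
        · have hall : ∀ i, m i < n := fun i => (hm.monotone (Fin.le_last i)).trans_lt hl
          simp [hm, hall, w, Fin.prod_univ_castSucc, mul_comm]
        · have hall : ¬ ∀ i, m i < n := fun H => hl (H _)
          simp [hall, w, hl]
      · simp [hm]
    · refine sum_congr rfl fun l hl => ?_
      simp only [w, if_pos (mem_range.1 hl)]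
      ring

lemma zetaMinus_ones_eq (k i : ℕ) :
    zetaMinus (fun j : Fin (k + 1) => if j = Fin.last k then 2 + i else 1) =
      ∑' n : ℕ, (-1 : ℝ) ^ n * elemHarmonic k n / ((n : ℝ) + 1) ^ (2 + i) := by
  have hnorm : Summable fun n : ℕ =>
      ‖(-1 : ℝ) ^ n / ((n : ℝ) + 1) ^ (2 + i)‖ * elemHarmonic k n := by
    refine (summable_elemHarmonic_div k i).congr fun n => ?_
    have : (0 : ℝ) < (n : ℝ) + 1 := by positivity
    simp [abs_of_pos this]
    ring
  have hsum : Summable fun n : ℕ =>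
      (-1 : ℝ) ^ n / ((n : ℝ) + 1) ^ (2 + i) * elemHarmonic k n := by
    refine Summable.of_norm (hnorm.congr fun n => ?_)
    rw [norm_mul, Real.norm_of_nonneg (elemHarmonic_nonneg k n)]
  have h := hasSum_strictMono_snoc (hasSum_elemHarmonic k) hnorm hsum.hasSum
  rw [zetaMinus]
  convert h.tsum_eq using 1
  · refine tsum_congr fun m => ?_
    congr 1
    rw [Fin.prod_univ_castSucc]
    simp
    ring
  · exact tsum_congr fun n => by ring

lemma hasSum_log_pow_succ_of_hasSum {k : ℕ}
    (hk : ∀ s : ℝ, 0 ≤ s → s < 1 → HasSum (fun n : ℕ => (-1) ^ (n + k) * elemHarmonic k n * s ^ n)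
      (Real.log (1 + s) ^ k / k.factorial / (1 + s))) {t : ℝ} (ht0 : 0 ≤ t) (ht1 : t < 1) :
    HasSum (fun n : ℕ => (-1) ^ (n + k) * elemHarmonic k n / (n + 1) * t ^ (n + 1))
      (Real.log (1 + t) ^ (k + 1) / (k + 1).factorial) := by
  have hI := intervalIntegral.hasSum_integral_of_dominated_convergence (a := 0) (b := t)
    (μ := volume) (F := fun n : ℕ => fun s : ℝ => (-1) ^ (n + k) * elemHarmonic k n * s ^ n)
    (f := fun s => Real.log (1 + s) ^ k / k.factorial / (1 + s))
    (fun n _ => elemHarmonic k n * t ^ n)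
    (fun n => (by fun_prop : Continuous fun s : ℝ =>
      (-1) ^ (n + k) * elemHarmonic k n * s ^ n).aestronglyMeasurable)
    (fun n => Eventually.of_forall fun s hs => by
      rw [Set.uIoc_of_le ht0] at hs
      have := elemHarmonic_nonneg k n
      simp only [norm_mul, norm_pow, norm_neg, norm_one, one_pow, one_mul,
        Real.norm_of_nonneg this, Real.norm_of_nonneg hs.1.le]
      gcongr
      exacts [hs.1.le, hs.2])
    (Eventually.of_forall fun s _ => summable_elemHarmonic_mul_pow k ht0 ht1)
    (by simp)
    (Eventually.of_forall fun s hs => by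
      rw [Set.uIoc_of_le ht0] at hs
      exact hk s hs.1.le (hs.2.trans_lt ht1))
  have hderiv : ∀ s ∈ Set.uIcc 0 t, HasDerivAt
      (fun s : ℝ => Real.log (1 + s) ^ (k + 1) / (k + 1).factorial)
      (Real.log (1 + s) ^ k / k.factorial / (1 + s)) s := by
    intro s hs
    rw [Set.uIcc_of_le ht0] at hs
    have hs0 : 0 < 1 + s := by linarith [hs.1]
    have h := ((((hasDerivAt_id s).const_add 1).log hs0.ne').pow (k + 1)).div_const
      ((k + 1).factorial : ℝ)
    refine h.congr_deriv ?_
    have hf : (k.factorial : ℝ) ≠ 0 := by positivity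
    simp only [id, Nat.factorial_succ]
    push_cast
    have : (k : ℝ) + 1 ≠ 0 := by positivity
    field_simp
  have hcont : ContinuousOn (fun s : ℝ => Real.log (1 + s) ^ k / k.factorial / (1 + s))
      (Set.uIcc 0 t) := by
    intro s hs
    rw [Set.uIcc_of_le ht0] at hs
    have hs0 : 1 + s ≠ 0 := by linarith [hs.1]
    exact ContinuousAt.continuousWithinAt (by fun_prop (disch := assumption))
  rw [intervalIntegral.integral_eq_sub_of_hasDerivAt hderiv hcont.intervalIntegrable] at hI
  refine hI.of_term_eq (fun n => ?_) ?_
  · rw [intervalIntegral.integral_const_mul, integral_pow]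
    simp
    ring
  · simp

lemma hasSum_log_pow_div {k : ℕ} {t : ℝ} (ht0 : 0 ≤ t) (ht1 : t < 1) :
    HasSum (fun n : ℕ => (-1) ^ (n + k) * elemHarmonic k n * t ^ n)
      (Real.log (1 + t) ^ k / k.factorial / (1 + t)) := by
  induction k generalizing t with
  | zero =>
    have h := hasSum_geometric_of_norm_lt_one (ξ := -t)
      (by rwa [norm_neg, Real.norm_of_nonneg ht0])
    refine h.of_term_eq (fun n => ?_) ?_
    · simp [elemHarmonic, neg_pow t]
    · simp
  | succ k ih =>
    have hT := hasSum_log_pow_succ_of_hasSum (fun s h0 h1 => ih h0 h1) ht0 ht1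
    set a : ℕ → ℝ := fun n => (-1) ^ (n + (k + 1)) * elemHarmonic (k + 1) n * t ^ n with ha
    have hs : Summable a := by
      refine Summable.of_norm ((summable_elemHarmonic_mul_pow (k + 1) ht0 ht1).congr fun n => ?_)
      simp [ha, abs_of_nonneg (elemHarmonic_nonneg (k + 1) n), abs_of_nonneg ht0]
    have hstep (n : ℕ) : a (n + 1) =
        -t * a n + (-1) ^ (n + k) * elemHarmonic k n / (n + 1) * t ^ (n + 1) := by
      simp only [ha, elemHarmonic_succ_succ]
      ring
    have hshift : HasSum (fun n => a (n + 1)) (∑' n, a n) := by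
      have h0 : a 0 = 0 := by simp [ha, elemHarmonic]
      simpa [h0] using (hasSum_nat_add_iff' 1).2 hs.hasSum
    simp only [hstep] at hshift
    have heq := hshift.unique ((hs.hasSum.mul_left (-t)).add hT)
    have hval : ∑' n, a n = Real.log (1 + t) ^ (k + 1) / (k + 1).factorial / (1 + t) := by
      rw [eq_div_iff (by linarith)]
      linarith
    rw [← hval]
    exact hs.hasSum

lemma hasSum_log_pow_succ (k : ℕ) {t : ℝ} (ht0 : 0 ≤ t) (ht1 : t < 1) :
    HasSum (fun n : ℕ => (-1) ^ (n + k) * elemHarmonic k n / (n + 1) * t ^ (n + 1))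
      (Real.log (1 + t) ^ (k + 1) / (k + 1).factorial) :=
  hasSum_log_pow_succ_of_hasSum (fun _ h0 h1 => hasSum_log_pow_div h0 h1) ht0 ht1

lemma tendsto_mul_neg_log_pow_nhdsGT_zero (i : ℕ) :
    Tendsto (fun t : ℝ => t * (-Real.log t) ^ i) (𝓝[>] 0) (𝓝 0) := by
  have h := (Real.tendsto_pow_mul_exp_neg_atTop_nhds_zero i).comp
    (tendsto_neg_atBot_atTop.comp Real.tendsto_log_nhdsGT_zero)
  refine h.congr' ?_
  filter_upwards [self_mem_nhdsWithin] with t ht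
  simp [Real.exp_log ht, mul_comm]

lemma continuousOn_pow_succ_mul_neg_log_pow (n i : ℕ) :
    ContinuousOn (fun t : ℝ => t ^ (n + 1) * (-Real.log t) ^ i) (Set.Icc 0 1) := by
  intro t ht
  rcases ht.1.eq_or_lt with rfl | hpos
  · have hIoi : Tendsto (fun t : ℝ => t ^ (n + 1) * (-Real.log t) ^ i) (𝓝[>] 0) (𝓝 0) := by
      have h := ((continuous_pow n).tendsto (0 : ℝ)).mono_left nhdsWithin_le_nhds |>.mul
        (tendsto_mul_neg_log_pow_nhdsGT_zero i)
      rw [mul_zero] at h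
      exact h.congr fun t => by ring
    have hc : ContinuousWithinAt (fun t : ℝ => t ^ (n + 1) * (-Real.log t) ^ i) (Set.Ioi 0) 0 := by
      simpa [ContinuousWithinAt] using hIoi
    exact (continuousWithinAt_Ioi_iff_Ici.1 hc).mono Set.Icc_subset_Ici_self
  · have := hpos.ne'
    exact ContinuousAt.continuousWithinAt (by fun_prop (disch := assumption))

/-- A primitive of `t ^ n * (-log t) ^ i` on `(0, 1)`. -/
noncomputable def powLogPrimitive (n : ℕ) : ℕ → ℝ → ℝ
  | 0, t => t ^ (n + 1) / (n + 1)
  | i + 1, t => t ^ (n + 1) * (-Real.log t) ^ (i + 1) / (n + 1) +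
      (i + 1) / (n + 1) * powLogPrimitive n i t

lemma hasDerivAt_powLogPrimitive (n i : ℕ) {t : ℝ} (ht : 0 < t) :
    HasDerivAt (powLogPrimitive n i) (t ^ n * (-Real.log t) ^ i) t := by
  have hn : (n : ℝ) + 1 ≠ 0 := by positivity
  induction i with
  | zero =>
    refine ((hasDerivAt_pow (n + 1) t).div_const ((n : ℝ) + 1)).congr_deriv ?_
    simp
    field_simp
  | succ i ih =>
    have h := (((hasDerivAt_pow (n + 1) t).mul
      ((Real.hasDerivAt_log ht.ne').neg.pow (i + 1))).div_const ((n : ℝ) + 1)).add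
        (ih.const_mul (((i : ℝ) + 1) / (n + 1)))
    refine h.congr_deriv ?_
    simp
    field_simp
    ring

lemma continuousOn_powLogPrimitive (n i : ℕ) :
    ContinuousOn (powLogPrimitive n i) (Set.Icc 0 1) := by
  induction i with
  | zero => exact ((continuous_pow (n + 1)).div_const _).continuousOn
  | succ i ih =>
    exact ((continuousOn_pow_succ_mul_neg_log_pow n (i + 1)).div_const _).add
      (continuousOn_const.mul ih)

lemma powLogPrimitive_zero (n i : ℕ) : powLogPrimitive n i 0 = 0 := by
  induction i with
  | zero => simp [powLogPrimitive]
  | succ i ih => simp [powLogPrimitive, ih]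

lemma powLogPrimitive_one (n i : ℕ) :
    powLogPrimitive n i 1 = i.factorial / ((n : ℝ) + 1) ^ (i + 1) := by
  induction i with
  | zero => simp [powLogPrimitive]
  | succ i ih =>
    have hn : (n : ℝ) + 1 ≠ 0 := by positivity
    simp [powLogPrimitive, ih, Nat.factorial_succ]
    field_simp
    ring

lemma intervalIntegrable_pow_mul_neg_log_pow (n i : ℕ) :
    IntervalIntegrable (fun t : ℝ => t ^ n * (-Real.log t) ^ i) volume 0 1 := by
  refine intervalIntegral.intervalIntegrable_deriv_of_nonneg (g := powLogPrimitive n i) ?_ ?_ ?_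
  · rw [Set.uIcc_of_le zero_le_one]
    exact continuousOn_powLogPrimitive n i
  · intro t ht
    exact hasDerivAt_powLogPrimitive n i (by simpa using ht.1)
  · intro t ht
    rw [min_eq_left zero_le_one, max_eq_right zero_le_one] at ht
    have := neg_nonneg.2 (Real.log_nonpos ht.1.le ht.2.le)
    have := ht.1
    positivity

lemma integral_pow_mul_neg_log_pow (n i : ℕ) :
    ∫ t in (0 : ℝ)..1, t ^ n * (-Real.log t) ^ i = i.factorial / ((n : ℝ) + 1) ^ (i + 1) := by
  rw [intervalIntegral.integral_eq_sub_of_hasDerivAt_of_le zero_le_one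
    (continuousOn_powLogPrimitive n i) (fun t ht => hasDerivAt_powLogPrimitive n i ht.1)
    (intervalIntegrable_pow_mul_neg_log_pow n i), powLogPrimitive_zero, powLogPrimitive_one,
    sub_zero]

lemma integrable_of_hasSum_of_summable_integral_norm {α : Type*} [MeasurableSpace α]
    {μ : Measure α} {F : ℕ → α → ℝ} {f : α → ℝ} (hF : ∀ n, Integrable (F n) μ)
    (hsum : Summable fun n => ∫ a, ‖F n a‖ ∂μ)
    (hf : ∀ᵐ a ∂μ, HasSum (fun n => F n a) (f a)) : Integrable f μ := by
  refine ⟨?_, ?_⟩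
  · refine aestronglyMeasurable_of_tendsto_ae atTop
      (f := fun N a => ∑ n ∈ range N, F n a) (fun N => ?_)
      (hf.mono fun a ha => ha.tendsto_sum_nat)
    exact Finset.aestronglyMeasurable_fun_sum _ fun n _ => (hF n).1
  · have hle : ∫⁻ a, ‖f a‖ₑ ∂μ ≤ ∑' n, ∫⁻ a, ‖F n a‖ₑ ∂μ := by
      rw [← lintegral_tsum fun n => (hF n).1.enorm]
      refine lintegral_mono_ae (hf.mono fun a ha => ?_)
      rw [← ha.tsum_eq]
      exact enorm_tsum_le_tsum_enorm
    refine hle.trans_lt (lt_top_iff_ne_top.2 ?_)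
    have hn (n : ℕ) : ∫⁻ a, ‖F n a‖ₑ ∂μ = ENNReal.ofReal (∫ a, ‖F n a‖ ∂μ) :=
      (ofReal_integral_norm_eq_lintegral_enorm (hF n)).symm
    simp only [hn]
    exact hsum.tsum_ofReal_ne_top

/-- Termwise integration of a power series against a power of the logarithm. -/
lemma hasSum_integral_mul_neg_log_pow {c : ℕ → ℝ} {f : ℝ → ℝ} (i : ℕ)
    (hc : Summable fun n : ℕ => |c n| / ((n : ℝ) + 1) ^ (i + 1))
    (hf : ∀ t, 0 < t → t < 1 → HasSum (fun n => c n * t ^ n) (f t)) :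
    IntervalIntegrable (fun t => f t * (-Real.log t) ^ i) volume 0 1 ∧
    HasSum (fun n : ℕ => i.factorial * (c n / ((n : ℝ) + 1) ^ (i + 1)))
      (∫ t in (0 : ℝ)..1, f t * (-Real.log t) ^ i) := by
  set μ : Measure ℝ := volume.restrict (Set.Ioo 0 1)
  have hbase (n : ℕ) : Integrable (fun t : ℝ => t ^ n * (-Real.log t) ^ i) μ := by
    have := intervalIntegrable_pow_mul_neg_log_pow n i
    rwa [intervalIntegrable_iff_integrableOn_Ioo_of_le zero_le_one] at this
  have hint (n : ℕ) : ∫ t, t ^ n * (-Real.log t) ^ i ∂μ =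
      i.factorial / ((n : ℝ) + 1) ^ (i + 1) := by
    rw [← integral_pow_mul_neg_log_pow, intervalIntegral.integral_of_le zero_le_one,
      integral_Ioc_eq_integral_Ioo]
  let F : ℕ → ℝ → ℝ := fun n t => c n * (t ^ n * (-Real.log t) ^ i)
  have hF (n : ℕ) : Integrable (F n) μ := (hbase n).const_mul _
  have hFnorm (n : ℕ) : ∫ t, ‖F n t‖ ∂μ = i.factorial * (|c n| / ((n : ℝ) + 1) ^ (i + 1)) := by
    have : ∫ t, ‖F n t‖ ∂μ = ∫ t, |c n| * (t ^ n * (-Real.log t) ^ i) ∂μ := by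
      refine setIntegral_congr_fun measurableSet_Ioo fun t ht => ?_
      have h1 := neg_nonneg.2 (Real.log_nonpos ht.1.le ht.2.le)
      have h2 := ht.1.le
      simp only [F, norm_mul, Real.norm_eq_abs]
      rw [abs_of_nonneg (pow_nonneg h2 n), abs_of_nonneg (pow_nonneg h1 i)]
    rw [this, integral_const_mul, hint]
    ring
  have hsum : Summable fun n => ∫ t, ‖F n t‖ ∂μ := by
    simp only [hFnorm]
    exact hc.mul_left _
  have hlim : ∀ᵐ t ∂μ, HasSum (fun n => F n t) (f t * (-Real.log t) ^ i) := by
    refine (ae_restrict_iff' measurableSet_Ioo).2 (Eventually.of_forall fun t ht => ?_)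
    exact ((hf t ht.1 ht.2).mul_right _).of_term_eq (fun n => by simp only [F]; ring) rfl
  constructor
  · rw [intervalIntegrable_iff_integrableOn_Ioo_of_le zero_le_one]
    exact integrable_of_hasSum_of_summable_integral_norm hF hsum hlim
  · have h := hasSum_integral_of_summable_integral_norm hF hsum
    rw [intervalIntegral.integral_of_le zero_le_one, integral_Ioc_eq_integral_Ioo]
    refine h.of_term_eq (fun n => ?_) ?_
    · rw [integral_const_mul, hint]
      ring
    · exact integral_congr_ae (hlim.mono fun t ht => ht.tsum_eq.symm)

lemma tendsto_log_one_add_nhdsGT_zero :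
    Tendsto (fun t : ℝ => Real.log (1 + t)) (𝓝[>] 0) (𝓝 0) := by
  have h : ContinuousAt (fun t : ℝ => Real.log (1 + t)) 0 :=
    ContinuousAt.log (by fun_prop) (by norm_num)
  simpa using h.tendsto.mono_left nhdsWithin_le_nhds

lemma tendsto_log_one_add_pow_mul_neg_log_pow (m j : ℕ) :
    Tendsto (fun t : ℝ => Real.log (1 + t) ^ (m + 1) * (-Real.log t) ^ j) (𝓝[>] 0) (𝓝 0) := by
  have hone : Tendsto (fun t : ℝ => Real.log (1 + t) * (-Real.log t) ^ j) (𝓝[>] 0) (𝓝 0) := by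
    refine squeeze_zero' ?_ ?_ (tendsto_mul_neg_log_pow_nhdsGT_zero j)
    all_goals
      filter_upwards [Ioo_mem_nhdsGT (zero_lt_one' ℝ)] with t ht
      have hb := pow_nonneg (neg_nonneg.2 (Real.log_nonpos ht.1.le ht.2.le)) j
    · exact mul_nonneg (Real.log_nonneg (by linarith [ht.1])) hb
    · refine mul_le_mul_of_nonneg_right ?_ hb
      linarith [Real.log_le_sub_one_of_pos (show 0 < 1 + t by linarith [ht.1])]
  have h := (tendsto_log_one_add_nhdsGT_zero.pow m).mul hone
  rw [mul_zero] at h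
  exact h.congr fun t => by ring

lemma tendsto_log_div_pow_sub_neg_log_pow (k : ℕ) :
    Tendsto (fun t : ℝ => (Real.log (1 + t) - Real.log t) ^ k - (-Real.log t) ^ k)
      (𝓝[>] 0) (𝓝 0) := by
  have h : Tendsto (fun t : ℝ => ∑ j ∈ range k,
      (-Real.log t) ^ j * Real.log (1 + t) ^ (k - j) * (k.choose j))
      (𝓝[>] 0) (𝓝 (∑ _j ∈ range k, 0)) := by
    refine tendsto_finsetSum _ fun j hj => ?_
    obtain ⟨m, hm⟩ : ∃ m, k - j = m + 1 :=
      ⟨k - j - 1, by have := mem_range.1 hj; omega⟩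
    rw [hm]
    have h' := (tendsto_log_one_add_pow_mul_neg_log_pow m j).mul_const (k.choose j : ℝ)
    rw [zero_mul] at h'
    exact h'.congr fun t => by ring
  rw [sum_const_zero] at h
  refine h.congr fun t => ?_
  rw [show Real.log (1 + t) - Real.log t = -Real.log t + Real.log (1 + t) by ring, add_pow,
    sum_range_succ]
  simp

lemma integral_log_eq_integral_inv_one_sub (k : ℕ)
    (hF : IntervalIntegrable (fun u : ℝ => (1 - u)⁻¹ * (-Real.log u) ^ k) volume 0 1)
    (hD : IntervalIntegrable (fun t : ℝ => Real.log (1 + t) ^ k / t +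
      ((Real.log (1 + t) - Real.log t) ^ k - (-Real.log t) ^ k) / t) volume 0 1) :
    ∫ t in (0 : ℝ)..1, (Real.log (1 + t) ^ k / t +
      ((Real.log (1 + t) - Real.log t) ^ k - (-Real.log t) ^ k) / t) =
    ∫ u in (0 : ℝ)..1, (1 - u)⁻¹ * (-Real.log u) ^ k := by
  set F : ℝ → ℝ := fun u => (1 - u)⁻¹ * (-Real.log u) ^ k with hFdef
  set Φ : ℝ → ℝ := fun x => ∫ u in (0 : ℝ)..x, F u with hΦdef
  have hFcont : ContinuousOn F (Set.Ioo 0 1) := by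
    intro u hu
    have h1 : 1 - u ≠ 0 := by linarith [hu.2]
    have h0 : u ≠ 0 := hu.1.ne'
    exact ContinuousAt.continuousWithinAt (by fun_prop (disch := assumption))
  have hΦderiv (x : ℝ) (hx : x ∈ Set.Ioo (0 : ℝ) 1) : HasDerivAt Φ (F x) x := by
    refine intervalIntegral.integral_hasDerivAt_right (hF.mono_set ?_)
      (hFcont.stronglyMeasurableAtFilter isOpen_Ioo x hx)
      (hFcont.continuousAt (isOpen_Ioo.mem_nhds hx))
    rw [Set.uIcc_of_le hx.1.le, Set.uIcc_of_le zero_le_one]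
    exact Set.Icc_subset_Icc_right hx.2.le
  have hΦcont : ContinuousOn Φ (Set.Icc 0 1) := by
    have := intervalIntegral.continuousOn_primitive_interval' hF
      (Set.left_mem_uIcc : (0 : ℝ) ∈ Set.uIcc 0 1)
    rwa [Set.uIcc_of_le zero_le_one] at this
  let G : ℝ → ℝ := fun t => Φ (t / (1 + t)) - Φ (1 / (1 + t)) +
    (Real.log (1 + t) ^ (k + 1) -
      ((Real.log (1 + t) - Real.log t) ^ (k + 1) - (-Real.log t) ^ (k + 1))) / (k + 1)
  have hmem (t : ℝ) (ht : 0 < t) :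
      t / (1 + t) ∈ Set.Ioo (0 : ℝ) 1 ∧ 1 / (1 + t) ∈ Set.Ioo (0 : ℝ) 1 := by
    refine ⟨⟨by positivity, ?_⟩, ⟨by positivity, ?_⟩⟩
    all_goals rw [div_lt_one (by positivity)]; linarith
  have hG (t : ℝ) (ht : 0 < t) : HasDerivAt G (Real.log (1 + t) ^ k / t +
      ((Real.log (1 + t) - Real.log t) ^ k - (-Real.log t) ^ k) / t) t := by
    have h1t : 1 + t ≠ 0 := by positivity
    have hadd : HasDerivAt (fun t : ℝ => 1 + t) 1 t := (hasDerivAt_id t).const_add 1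
    have hp := (hasDerivAt_id t).div hadd h1t
    have hq := (hasDerivAt_const t (1 : ℝ)).div hadd h1t
    have hl := hadd.log h1t
    have hlt := Real.hasDerivAt_log ht.ne'
    have h := (((hΦderiv _ (hmem t ht).1).comp t hp).sub
      ((hΦderiv _ (hmem t ht).2).comp t hq)).add
      (((hl.pow (k + 1)).sub (((hl.sub hlt).pow (k + 1)).sub
        (hlt.neg.pow (k + 1)))).div_const ((k : ℝ) + 1))
    refine h.congr_deriv ?_
    have hk : (k : ℝ) + 1 ≠ 0 := by positivity
    have hlog1 : Real.log (t / (1 + t)) = Real.log t - Real.log (1 + t) :=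
      Real.log_div ht.ne' h1t
    have hlog2 : Real.log (1 / (1 + t)) = -Real.log (1 + t) := by simp
    have hc1 : 1 - t / (1 + t) = 1 / (1 + t) := by field_simp; ring
    have hc2 : 1 - 1 / (1 + t) = t / (1 + t) := by field_simp; ring
    simp only [hFdef, id, hlog1, hlog2, hc1, hc2, neg_sub, neg_neg, Pi.sub_apply, Pi.neg_apply,
      add_tsub_cancel_right]
    push_cast
    field_simp
    ring
  have hzero : Tendsto G (𝓝[>] 0) (𝓝 (-Φ 1)) := by
    have hin (p : ℝ → ℝ) (hp : ContinuousAt p 0) (hp0 : p 0 ∈ Set.Icc (0 : ℝ) 1)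
        (hpm : ∀ t, 0 < t → p t ∈ Set.Ioo (0 : ℝ) 1) :
        Tendsto (fun t => Φ (p t)) (𝓝[>] 0) (𝓝 (Φ (p 0))) := by
      refine (hΦcont (p 0) hp0).tendsto.comp (tendsto_nhdsWithin_iff.2 ⟨?_, ?_⟩)
      · exact hp.tendsto.mono_left nhdsWithin_le_nhds
      · filter_upwards [self_mem_nhdsWithin] with t ht
        exact Set.Ioo_subset_Icc_self (hpm t ht)
    have h1 := hin (fun t => t / (1 + t))
      (ContinuousAt.div (by fun_prop) (by fun_prop) (by norm_num)) (by simp)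
      fun t ht => (hmem t ht).1
    have h2 := hin (fun t => 1 / (1 + t))
      (ContinuousAt.div (by fun_prop) (by fun_prop) (by norm_num)) (by simp)
      fun t ht => (hmem t ht).2
    have h3 := (((tendsto_log_one_add_nhdsGT_zero.pow (k + 1)).sub
      (tendsto_log_div_pow_sub_neg_log_pow (k + 1))).div_const ((k : ℝ) + 1))
    have h := (h1.sub h2).add h3
    simpa [hΦdef, G] using h
  have hone : Tendsto G (𝓝[<] 1) (𝓝 0) := by
    have h := (hG 1 one_pos).continuousAt.tendsto.mono_left (nhdsWithin_le_nhds (s := Set.Iio 1))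
    simpa [G] using h
  rw [intervalIntegral.integral_eq_sub_of_hasDerivAt_of_tendsto one_pos
    (fun t ht => hG t ht.1) hD hzero hone]
  simp [hΦdef]

lemma integral_log_pow_eq_zetaMinus (j i : ℕ) :
    IntervalIntegrable (fun t : ℝ => Real.log (1 + t) ^ (j + 1) / (j + 1).factorial / t *
      (-Real.log t) ^ i) volume 0 1 ∧
    ∫ t in (0 : ℝ)..1, Real.log (1 + t) ^ (j + 1) / (j + 1).factorial / t * (-Real.log t) ^ i =
      i.factorial * ((-1) ^ j *
        zetaMinus (fun l : Fin (j + 1) => if l = Fin.last j then 2 + i else 1)) := by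
  have hdiv (n : ℕ) (x : ℝ) : x / ((n : ℝ) + 1) / ((n : ℝ) + 1) ^ (i + 1) =
      x / ((n : ℝ) + 1) ^ (2 + i) := by
    rw [div_div]; congr 1; ring
  have h := hasSum_integral_mul_neg_log_pow
    (c := fun n : ℕ => (-1) ^ (n + j) * elemHarmonic j n / ((n : ℝ) + 1))
    (f := fun t => Real.log (1 + t) ^ (j + 1) / (j + 1).factorial / t) i ?_ ?_
  · refine ⟨h.1, ?_⟩
    rw [← h.2.tsum_eq, zetaMinus_ones_eq, ← tsum_mul_left, ← tsum_mul_left]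
    refine tsum_congr fun n => ?_
    rw [hdiv, pow_add]
    ring
  · refine (summable_elemHarmonic_div j i).congr fun n => ?_
    have hn : (0 : ℝ) < (n : ℝ) + 1 := by positivity
    rw [← hdiv, abs_div, abs_mul, abs_pow, abs_neg, abs_one, one_pow, one_mul,
      abs_of_nonneg (elemHarmonic_nonneg j n), abs_of_pos hn]
  · intro t ht0 ht1
    refine ((hasSum_log_pow_succ j ht0.le ht1).div_const t).of_term_eq (fun n => ?_) rfl
    rw [pow_succ]
    field_simp

lemma hasSum_integral_inv_one_sub (k : ℕ) (hk : 1 ≤ k) :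
    IntervalIntegrable (fun u : ℝ => (1 - u)⁻¹ * (-Real.log u) ^ k) volume 0 1 ∧
    ∫ u in (0 : ℝ)..1, (1 - u)⁻¹ * (-Real.log u) ^ k =
      k.factorial * ∑' n : ℕ, 1 / ((n : ℝ) + 1) ^ (k + 1) := by
  have h := hasSum_integral_mul_neg_log_pow (c := fun _ => 1) (f := fun t => (1 - t)⁻¹) k ?_ ?_
  · exact ⟨h.1, by rw [← h.2.tsum_eq, tsum_mul_left]⟩
  · have := (summable_nat_add_iff 1).2
      (Real.summable_one_div_nat_pow (p := k + 1) |>.2 (by omega))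
    simpa using this
  · intro t ht0 ht1
    simpa using hasSum_geometric_of_lt_one ht0.le ht1

lemma pow_add_add_pow_sub_pow_eq_sum (r : ℕ) (a b t : ℝ) :
    a ^ (r + 1) / t + ((a + b) ^ (r + 1) - b ^ (r + 1)) / t =
      ∑ i ∈ range (r + 1), (r + 1).factorial * ((if i = 0 then 1 else 0) + 1) / i.factorial *
        (a ^ (r - i + 1) / (r - i + 1).factorial / t * b ^ i) := by
  have hterm (i : ℕ) (hi : i ∈ range (r + 1)) :
      ((r + 1).factorial : ℝ) * ((if i = 0 then 1 else 0) + 1) / i.factorial *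
        (a ^ (r - i + 1) / (r - i + 1).factorial / t * b ^ i) =
      (if i = 0 then a ^ (r + 1) / t else 0) +
        b ^ i * a ^ (r + 1 - i) * ((r + 1).choose i) / t := by
    have hir : i ≤ r := by simpa [Nat.lt_succ_iff] using hi
    rw [Nat.cast_choose ℝ (by omega : i ≤ r + 1), show r - i + 1 = r + 1 - i by omega]
    split_ifs with h0
    · subst h0
      simp
      field_simp
    · ring
  rw [sum_congr rfl hterm, sum_add_distrib, ← sum_div, sum_ite_eq' (range (r + 1)) 0]
  rw [add_comm a b, add_pow b a (r + 1), sum_range_succ _ (r + 1)]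
  simp

theorem stmt3 (r : ℕ) :
    ((∑ i ∈ Finset.range (r + 1),
      (-1 : ℝ) ^ (r - i) * ((if i = 0 then 1 else 0) + 1)
        * zetaMinus (fun j : Fin (r - i + 1) => if j = Fin.last (r - i) then 2 + i else 1) : ℝ) : ℂ)
    = riemannZeta (r + 2) := by
  let g : ℕ → ℝ → ℝ := fun i t => (r + 1).factorial * ((if i = 0 then 1 else 0) + 1) /
    i.factorial * (Real.log (1 + t) ^ (r - i + 1) / (r - i + 1).factorial / t * (-Real.log t) ^ i)
  have hg (i : ℕ) : IntervalIntegrable (g i) volume 0 1 :=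
    (integral_log_pow_eq_zetaMinus (r - i) i).1.const_mul _
  have hsum : (fun t : ℝ => Real.log (1 + t) ^ (r + 1) / t +
      ((Real.log (1 + t) - Real.log t) ^ (r + 1) - (-Real.log t) ^ (r + 1)) / t) =
      fun t => ∑ i ∈ range (r + 1), g i t :=
    funext fun t => by
      rw [sub_eq_add_neg (Real.log (1 + t))]
      exact pow_add_add_pow_sub_pow_eq_sum r _ _ t
  have hF := hasSum_integral_inv_one_sub (r + 1) (by omega)
  have hD : IntervalIntegrable (fun t => ∑ i ∈ range (r + 1), g i t) volume 0 1 :=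
    by simpa [← Finset.sum_fn] using
      IntervalIntegrable.sum (range (r + 1)) (f := g) fun i _ => hg i
  have hI := integral_log_eq_integral_inv_one_sub (r + 1) hF.1 (hsum ▸ hD)
  rw [hsum, hF.2, intervalIntegral.integral_finsetSum fun i _ => hg i] at hI
  have hfac : ((r + 1).factorial : ℝ) ≠ 0 := by positivity
  have hreal : ∑ i ∈ Finset.range (r + 1),
      (-1 : ℝ) ^ (r - i) * ((if i = 0 then 1 else 0) + 1)
        * zetaMinus (fun j : Fin (r - i + 1) => if j = Fin.last (r - i) then 2 + i else 1) =
      ∑' n : ℕ, 1 / ((n : ℝ) + 1) ^ (r + 1 + 1) := by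
    refine mul_left_cancel₀ hfac (Eq.trans ?_ hI)
    rw [mul_sum]
    refine sum_congr rfl fun i _ => ?_
    have hi : (i.factorial : ℝ) ≠ 0 := by positivity
    simp only [g]
    rw [intervalIntegral.integral_const_mul, (integral_log_pow_eq_zetaMinus (r - i) i).2]
    field_simp
  rw [hreal, zeta_eq_tsum_one_div_nat_add_one_cpow (by simp; linarith), Complex.ofReal_tsum]
  refine tsum_congr fun n => ?_
  rw [show (r : ℂ) + 2 = ((r + 1 + 1 : ℕ) : ℂ) by push_cast; ring, Complex.cpow_natCast]
  push_cast
  rfl
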